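/- Let n ≥ 1, A ∈ Mₙ(ℍ), and λ ∈ ℂ. Then λ is a right eigenvalue of A, i.e. there exists a nonzero ξ ∈ ℍⁿ with (A·ξ)_k = ξ_k·ι(λ) for all k (where (A·ξ)_k = ∑_ℓ A_{kℓ}·ξ_ℓ), if and only if λ is an eigenvalue of the complex matrix χₙ(A) ∈ M_{2n}(ℂ), i.e. there exists a nonzero v ∈ ℂ^{2n} with χₙ(A)·v = λ·v. -/

import Mathlib

open Matrix
open scoped Quaternion

/-- The slice embedding `ι : ℂ → ℍ`, `a + bi ↦ a + bi`. -/
def iota (z : ℂ) : ℍ[ℝ] := ⟨z.re, z.im, 0, 0⟩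

/-- The extension of the standard embedding `χ` to quaternionic `n × n` matrices:
writing `A = A₁ + A₂·j` entrywise with `A₁, A₂` complex matrices,
`χₙ(A) = [[A₁, A₂], [−conj A₂, conj A₁]]` as a `2 × 2` block matrix. -/
noncomputable def chiN {n : ℕ} (A : Matrix (Fin n) (Fin n) ℍ[ℝ]) :
    Matrix (Fin n ⊕ Fin n) (Fin n ⊕ Fin n) ℂ :=
  Matrix.fromBlocks
    (Matrix.of fun k ℓ => (⟨(A k ℓ).re, (A k ℓ).imI⟩ : ℂ))
    (Matrix.of fun k ℓ => (⟨(A k ℓ).imJ, (A k ℓ).imK⟩ : ℂ))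
    (-(Matrix.of fun k ℓ => (starRingEnd ℂ (⟨(A k ℓ).imJ, (A k ℓ).imK⟩ : ℂ))))
    (Matrix.of fun k ℓ => (starRingEnd ℂ (⟨(A k ℓ).re, (A k ℓ).imI⟩ : ℂ)))

@[simp]
theorem iota_re (z : ℂ) : (iota z).re = z.re := rfl

@[simp]
theorem iota_imI (z : ℂ) : (iota z).imI = z.im := rfl

@[simp]
theorem iota_imJ (z : ℂ) : (iota z).imJ = 0 := rfl

@[simp]
theorem iota_imK (z : ℂ) : (iota z).imK = 0 := rfl

/-- The first column of `χ`, taken entrywise, as an additive bijection: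
`ξ₁ + ξ₂·j ↦ (ξ₁, −conj ξ₂)`. -/
def chiColumn {ι : Type*} : (ι → ℍ[ℝ]) ≃+ (ι ⊕ ι → ℂ) where
  toFun ξ := Sum.elim (fun k => ⟨(ξ k).re, (ξ k).imI⟩) (fun k => ⟨-(ξ k).imJ, (ξ k).imK⟩)
  invFun v k := ⟨(v (Sum.inl k)).re, (v (Sum.inl k)).im,
    -(v (Sum.inr k)).re, (v (Sum.inr k)).im⟩
  left_inv ξ := by
    ext k <;> simp
  right_inv v := by
    ext (k | k) <;> simp
  map_add' ξ η := by
    ext1 (k | k) <;> apply Complex.ext <;> simp <;> ring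

@[simp]
theorem chiColumn_apply_inl {ι : Type*} (ξ : ι → ℍ[ℝ]) (k : ι) :
    chiColumn ξ (Sum.inl k) = ⟨(ξ k).re, (ξ k).imI⟩ := rfl

@[simp]
theorem chiColumn_apply_inr {ι : Type*} (ξ : ι → ℍ[ℝ]) (k : ι) :
    chiColumn ξ (Sum.inr k) = ⟨-(ξ k).imJ, (ξ k).imK⟩ := rfl

theorem chiN_mulVec_chiColumn {n : ℕ} (A : Matrix (Fin n) (Fin n) ℍ[ℝ]) (ξ : Fin n → ℍ[ℝ]) :
    (chiN A).mulVec (chiColumn ξ) = chiColumn fun k => ∑ ℓ, A k ℓ * ξ ℓ := by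
  have hsum : (fun k => ∑ ℓ, A k ℓ * ξ ℓ) = ∑ ℓ, fun k => A k ℓ * ξ ℓ := by
    ext1 k
    simp
  rw [hsum, map_sum]
  ext1 i
  rw [Finset.sum_apply]
  simp only [Matrix.mulVec, dotProduct, Fintype.sum_sum_type, ← Finset.sum_add_distrib]
  refine Finset.sum_congr rfl fun ℓ _ => ?_
  rcases i with k | k <;> apply Complex.ext <;> simp [chiN] <;> ring

theorem chiColumn_mul_iota {ι : Type*} (ξ : ι → ℍ[ℝ]) (z : ℂ) :
    (chiColumn fun k => ξ k * iota z) = z • chiColumn ξ := by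
  ext1 (k | k) <;> apply Complex.ext <;> simp <;> ring

/-- Zhang's right-eigenvalue correspondence: a complex number `λ` is a right eigenvalue
of a quaternionic matrix `A` if and only if it is an eigenvalue of `χₙ(A)`. -/
theorem right_eigenvalue_iff_chiN_eigenvalue
    (n : ℕ) (hn : 1 ≤ n) (A : Matrix (Fin n) (Fin n) ℍ[ℝ]) (lam : ℂ) :
    (∃ ξ : Fin n → ℍ[ℝ], ξ ≠ 0 ∧ ∀ k, ∑ ℓ, A k ℓ * ξ ℓ = ξ k * iota lam) ↔
    (∃ v : (Fin n ⊕ Fin n) → ℂ, v ≠ 0 ∧ (chiN A).mulVec v = lam • v) := by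
  constructor
  · rintro ⟨ξ, hξ, h⟩
    refine ⟨chiColumn ξ, by simpa using hξ, ?_⟩
    rw [chiN_mulVec_chiColumn, ← chiColumn_mul_iota, funext h]
  · rintro ⟨v, hv, h⟩
    obtain ⟨ξ, rfl⟩ := chiColumn.surjective v
    refine ⟨ξ, by simpa using hv, ?_⟩
    rw [chiN_mulVec_chiColumn, ← chiColumn_mul_iota] at h
    exact congrFun (chiColumn.injective h)
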